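/- arXiv:2112.06870 — 4 statements merged into one kernel-verified Lean document; each statement's English description precedes it below -/
import Mathlib

section
/- Let d ≥ 1 and let E := Σ_{i=1}^{d-1} i·E_{i,i+1}, F := Σ_{i=1}^{d-1} (d−i)·E_{i+1,i}, H := Σ_{i=1}^{d} (d+1−2i)·E_{i,i} be d×d complex matrices. Then for every integer n with 0 ≤ n ≤ d−1 such that d−1−n is even, the trace Tr(E^n · F^n · H^{d−1−n}) is nonzero (indeed it is a positive integer). -/
open Matrix

/-- `E = ∑_{i=1}^{d-1} i · E_{i,i+1}` (1-based indices), written entrywise with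
0-based indices: the `(a, a+1)` entry is `a+1`. -/
noncomputable def matE (d : ℕ) : Matrix (Fin d) (Fin d) ℂ :=
  Matrix.of fun a b => if (b : ℕ) = (a : ℕ) + 1 then (((a : ℕ) + 1 : ℕ) : ℂ) else 0

/-- `F = ∑_{i=1}^{d-1} (d-i) · E_{i+1,i}`: the `(b+1, b)` entry is `d - (b+1)`. -/
noncomputable def matF (d : ℕ) : Matrix (Fin d) (Fin d) ℂ :=
  Matrix.of fun a b => if (a : ℕ) = (b : ℕ) + 1 then ((d : ℂ) - (((b : ℕ) + 1 : ℕ) : ℂ)) else 0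

/-- `H = ∑_{i=1}^{d} (d+1-2i) · E_{i,i}`: the `(a, a)` entry is `d + 1 - 2(a+1)`. -/
noncomputable def matH (d : ℕ) : Matrix (Fin d) (Fin d) ℂ :=
  Matrix.of fun a b => if a = b then ((d : ℂ) + 1 - 2 * (((a : ℕ) + 1 : ℕ) : ℂ)) else 0


/-- The natural number matrix whose cast to `ℂ` is `matE d`. -/
def natE (d : ℕ) : Matrix (Fin d) (Fin d) ℕ :=
  Matrix.of fun a b => if (b : ℕ) = (a : ℕ) + 1 then (a : ℕ) + 1 else 0

/-- The natural number matrix whose cast to `ℂ` is `matF d`. -/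
def natF (d : ℕ) : Matrix (Fin d) (Fin d) ℕ :=
  Matrix.of fun a b => if (a : ℕ) = (b : ℕ) + 1 then d - ((b : ℕ) + 1) else 0

/-- The natural number matrix whose cast to `ℂ` is `matH d * matH d`. -/
def natHSq (d : ℕ) : Matrix (Fin d) (Fin d) ℕ :=
  Matrix.diagonal fun a => ((d : ℤ) + 1 - 2 * ((a : ℕ) + 1)).natAbs ^ 2

theorem natE_map_cast (d : ℕ) : (natE d).map (Nat.castRingHom ℂ) = matE d := by
  ext a b
  simp [natE, matE]

theorem natF_map_cast (d : ℕ) : (natF d).map (Nat.castRingHom ℂ) = matF d := by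
  ext a b
  have hb : (b : ℕ) + 1 ≤ d := b.isLt
  simp [natF, matF, Nat.cast_sub hb]

theorem natHSq_map_cast (d : ℕ) :
    (natHSq d).map (Nat.castRingHom ℂ) = matH d * matH d := by
  have hH : matH d =
      Matrix.diagonal fun a : Fin d => (d : ℂ) + 1 - 2 * (((a : ℕ) + 1 : ℕ) : ℂ) := by
    ext a b
    simp [matH, Matrix.diagonal_apply]
  rw [hH, Matrix.diagonal_mul_diagonal, natHSq, Matrix.diagonal_map (map_zero _)]
  congr 1
  funext a
  have h := congrArg (Int.cast : ℤ → ℂ) (Int.natAbs_sq ((d : ℤ) + 1 - 2 * ((a : ℕ) + 1)))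
  push_cast at h
  simp only [map_pow, Nat.coe_castRingHom]
  rw [← Int.cast_natCast, Int.natCast_natAbs, h]
  push_cast
  ring

theorem mul_apply_pos_of_pos {ι : Type*} [Fintype ι] {A B : Matrix ι ι ℕ} {i j k : ι}
    (hA : 0 < A i j) (hB : 0 < B j k) : 0 < (A * B) i k := by
  rw [Matrix.mul_apply]
  exact Finset.sum_pos' (fun _ _ => Nat.zero_le _) ⟨j, Finset.mem_univ j, Nat.mul_pos hA hB⟩

theorem natE_pow_apply_pos {d n : ℕ} (hn : n < d) :
    0 < (natE d ^ n) ⟨0, by omega⟩ ⟨n, hn⟩ := by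
  induction n with
  | zero => simp
  | succ n ih =>
    rw [pow_succ]
    exact mul_apply_pos_of_pos (ih (by omega)) (by simp [natE])

theorem natF_pow_apply_pos {d n : ℕ} (hn : n < d) :
    0 < (natF d ^ n) ⟨n, hn⟩ ⟨0, by omega⟩ := by
  induction n with
  | zero => simp
  | succ n ih =>
    rw [pow_succ']
    exact mul_apply_pos_of_pos (j := ⟨n, by omega⟩) (by simp [natF]; omega) (ih (by omega))

theorem natHSq_pow_apply_zero_pos {d k : ℕ} (hd : 0 < d) (hk : k = 0 ∨ 1 < d) :
    0 < (natHSq d ^ k) ⟨0, hd⟩ ⟨0, hd⟩ := by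
  rw [natHSq, Matrix.diagonal_pow, Matrix.diagonal_apply_eq, Pi.pow_apply]
  rcases hk with rfl | hk
  · simp
  · have : 0 < ((d : ℤ) + 1 - 2 * ((0 : ℕ) + 1)).natAbs := by omega
    positivity

/-- For `0 ≤ n ≤ d-1` with `d-1-n` even, `Tr(Eⁿ·Fⁿ·H^{d-1-n})` is a positive
integer; in particular it is nonzero. -/
theorem stmt5 (d : ℕ) (hd : 1 ≤ d) (n : ℕ) (hn : n ≤ d - 1) (hpar : Even (d - 1 - n)) :
    Matrix.trace ((matE d) ^ n * (matF d) ^ n * (matH d) ^ (d - 1 - n)) ≠ 0 ∧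
    ∃ m : ℕ, 0 < m ∧
      Matrix.trace ((matE d) ^ n * (matF d) ^ n * (matH d) ^ (d - 1 - n)) = (m : ℂ) := by
  obtain ⟨k, hk⟩ := hpar
  have hpos : 0 < Matrix.trace (natE d ^ n * natF d ^ n * natHSq d ^ k) :=
    Finset.sum_pos' (fun _ _ => Nat.zero_le _) ⟨⟨0, hd⟩, Finset.mem_univ _,
      mul_apply_pos_of_pos
        (mul_apply_pos_of_pos (natE_pow_apply_pos (by omega)) (natF_pow_apply_pos (by omega)))
        (natHSq_pow_apply_zero_pos hd (by omega))⟩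
  have hcast : Matrix.trace ((matE d) ^ n * (matF d) ^ n * (matH d) ^ (d - 1 - n)) =
      ((Matrix.trace (natE d ^ n * natF d ^ n * natHSq d ^ k) : ℕ) : ℂ) := by
    rw [hk, ← two_mul, pow_mul, pow_two, ← natE_map_cast, ← natF_map_cast, ← natHSq_map_cast,
      ← Matrix.map_pow, ← Matrix.map_pow, ← Matrix.map_pow, ← Matrix.map_mul, ← Matrix.map_mul]
    exact (AddMonoidHom.map_trace (Nat.castRingHom ℂ) _).symm
  refine ⟨?_, _, hpos, hcast⟩
  rw [hcast]
  exact_mod_cast hpos.ne'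
end

section
/- Let d ≥ 2 and let E := Σ_{i=1}^{d-1} i·E_{i,i+1}, F := Σ_{i=1}^{d-1} (d−i)·E_{i+1,i}, H := Σ_{i=1}^{d} (d+1−2i)·E_{i,i} be d×d complex matrices. Then Tr(E^{d−2} · F^{d−2} · H) = (2d−4)(d−1)((d−2)!)²; in particular this trace is nonzero for d ≥ 3. -/
open Matrix

theorem matE_pow_apply (d k : ℕ) (a b : Fin d) :
    (matE d ^ k) a b =
      if (b : ℕ) = a + k then ((((a : ℕ) + 1).ascFactorial k : ℕ) : ℂ) else 0 := by
  induction k generalizing b with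
  | zero => simp [Matrix.one_apply, Fin.ext_iff, eq_comm]
  | succ k ih =>
    rw [pow_succ, Matrix.mul_apply]
    simp only [ih]
    split_ifs with h
    · have hlt : (a : ℕ) + k < d := by omega
      rw [Finset.sum_eq_single (⟨a + k, hlt⟩ : Fin d)]
      · have hb : (b : ℕ) = a + k + 1 := by omega
        simp only [matE, Matrix.of_apply, hb, if_true, Nat.ascFactorial_succ]
        push_cast
        ring
      · intro c _ hc
        rw [if_neg fun h' => hc (Fin.ext h'), zero_mul]
      · simp
    · refine Finset.sum_eq_zero fun c _ => ?_
      simp only [matE, Matrix.of_apply]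
      split_ifs <;> first | omega | simp

theorem matF_pow_apply (d k : ℕ) (a b : Fin d) :
    (matF d ^ k) a b =
      if (a : ℕ) = b + k then (((d - 1 - (b : ℕ)).descFactorial k : ℕ) : ℂ) else 0 := by
  induction k generalizing a with
  | zero => simp [Matrix.one_apply, Fin.ext_iff]
  | succ k ih =>
    rw [pow_succ', Matrix.mul_apply]
    simp only [ih]
    split_ifs with h
    · have hlt : (b : ℕ) + k < d := by omega
      rw [Finset.sum_eq_single (⟨b + k, hlt⟩ : Fin d)]
      · have ha : (a : ℕ) = b + k + 1 := by omega
        have hsub : d - 1 - (b : ℕ) - k = d - (b + k + 1) := by omega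
        simp only [matF, Matrix.of_apply, ha, if_true, Nat.descFactorial_succ, hsub]
        rw [Nat.cast_mul, Nat.cast_sub (by omega)]
      · intro c _ hc
        rw [if_neg fun h' => hc (Fin.ext h'), mul_zero]
      · simp
    · refine Finset.sum_eq_zero fun c _ => ?_
      simp only [matF, Matrix.of_apply]
      split_ifs <;> first | omega | simp

theorem matE_pow_mul_matF_pow_apply_self (d k : ℕ) (a : Fin d) :
    (matE d ^ k * matF d ^ k) a a =
      if (a : ℕ) + k < d then
        ((((a : ℕ) + 1).ascFactorial k * (d - 1 - (a : ℕ)).descFactorial k : ℕ) : ℂ)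
      else 0 := by
  simp only [Matrix.mul_apply, matE_pow_apply, matF_pow_apply]
  split_ifs with h
  · rw [Finset.sum_eq_single (⟨a + k, h⟩ : Fin d)]
    · simp
    · intro c _ hc
      rw [if_neg fun h' => hc (Fin.ext h'), zero_mul]
    · simp
  · refine Finset.sum_eq_zero fun c _ => ?_
    rw [if_neg (by omega), zero_mul]

theorem matH_eq_diagonal (d : ℕ) :
    matH d = Matrix.diagonal fun a : Fin d => (d : ℂ) + 1 - 2 * (((a : ℕ) + 1 : ℕ) : ℂ) := by
  ext a b
  simp [matH, Matrix.diagonal_apply]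

theorem trace_matE_pow_mul_matF_pow_mul_matH (n : ℕ) :
    Matrix.trace (matE (n + 2) ^ n * matF (n + 2) ^ n * matH (n + 2)) =
      2 * (n : ℂ) * ((n : ℂ) + 1) * (n.factorial : ℂ) ^ 2 := by
  have hdesc : (n + 1).descFactorial n = (n + 1).factorial := by
    have := Nat.factorial_mul_descFactorial (Nat.le_succ n)
    simpa using this
  have hasc : Nat.ascFactorial 2 n = (n + 1).factorial := by
    have := Nat.factorial_mul_ascFactorial 1 n
    simpa [add_comm] using this
  simp only [Matrix.trace, Matrix.diag_apply, matH_eq_diagonal, Matrix.mul_diagonal,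
    matE_pow_mul_matF_pow_apply_self]
  rw [Fin.sum_univ_succ, Fin.sum_univ_succ, Finset.sum_eq_zero]
  · simp [hdesc, hasc, Nat.one_ascFactorial, Nat.descFactorial_self, Nat.factorial_succ,
      show 1 + n < n + 2 by omega]
    ring
  · intro c _
    rw [if_neg (by simp only [Fin.val_succ]; omega), zero_mul]

/-- For `d ≥ 2`, `Tr(E^{d-2}·F^{d-2}·H) = (2d-4)(d-1)((d-2)!)²`; in particular
this trace is nonzero for `d ≥ 3`. -/
theorem stmt7 (d : ℕ) (hd : 2 ≤ d) :
    Matrix.trace ((matE d) ^ (d - 2) * (matF d) ^ (d - 2) * matH d) =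
      (2 * (d : ℂ) - 4) * ((d : ℂ) - 1) * ((Nat.factorial (d - 2) : ℕ) : ℂ) ^ 2 ∧
    (3 ≤ d → Matrix.trace ((matE d) ^ (d - 2) * (matF d) ^ (d - 2) * matH d) ≠ 0) := by
  obtain ⟨n, rfl⟩ := Nat.exists_eq_add_of_le' hd
  rw [Nat.add_sub_cancel, trace_matE_pow_mul_matF_pow_mul_matH]
  refine ⟨by push_cast; ring, fun hn => ?_⟩
  have hn0 : (n : ℂ) ≠ 0 := Nat.cast_ne_zero.mpr (by omega)
  have hn1 : (n : ℂ) + 1 ≠ 0 := Nat.cast_add_one_ne_zero n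
  have hfac : (n.factorial : ℂ) ≠ 0 := Nat.cast_ne_zero.mpr n.factorial_ne_zero
  exact mul_ne_zero (mul_ne_zero (mul_ne_zero two_ne_zero hn0) hn1) (pow_ne_zero 2 hfac)
end

section
/- Let d ≥ 3 and let λ be a partition (of any integer m ≥ 0). Then the number of chains λ = λ⁽⁰⁾ ⊂ λ⁽¹⁾ ⊂ ⋯ ⊂ λ⁽ᵈ⁻¹⁾ of partitions, in which each λ⁽ʲ⁾ is obtained from λ⁽ʲ⁻¹⁾ by adding exactly one box (i.e. |λ⁽ʲ⁾| = |λ⁽ʲ⁻¹⁾| + 1 and λ⁽ʲ⁻¹⁾ ⊂ λ⁽ʲ⁾), and whose final partition μ = λ⁽ᵈ⁻¹⁾ = (μ₁, μ₂, μ₃) has at most 3 non-zero parts with μ₁ ≡ μ₂ ≡ μ₃ modulo 2, is at most 3^{d−2}. -/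
/-- A partition, encoded as the weakly decreasing sequence of its parts
(`p k` is the `(k+1)`-th part), with finitely many nonzero parts. -/
def IsPartitionFun (p : ℕ → ℕ) : Prop :=
  Antitone p ∧ ∃ N, ∀ k, N ≤ k → p k = 0

/-- `AddBox p q` means the partition `q` is obtained from the partition `p` by
adding exactly one box (so `p ⊂ q` and `|q| = |p| + 1`). -/
def AddBox (p q : ℕ → ℕ) : Prop :=
  ∃ i, q i = p i + 1 ∧ ∀ j, j ≠ i → q j = p j

/-- Adding a box only changes one part, so a box added to obtain a partition with at most three
nonzero parts lies in one of the first three rows. -/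
theorem AddBox.exists_fin_three {p q : ℕ → ℕ} (h : AddBox p q) (hq : ∀ i, 3 ≤ i → q i = 0) :
    ∃ a : Fin 3, q = p + Pi.single (a : ℕ) 1 := by
  obtain ⟨i, hi, hj⟩ := h
  have hi3 : i < 3 := by
    by_contra hlt
    have := hq i (by omega)
    omega
  refine ⟨⟨i, hi3⟩, funext fun k => ?_⟩
  by_cases hk : k = i
  · subst hk
    simp [hi]
  · simp [hj k hk, hk]

theorem AddBox.le {p q : ℕ → ℕ} (h : AddBox p q) : p ≤ q := by
  obtain ⟨i, hi, hj⟩ := h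
  intro k
  by_cases hk : k = i
  · subst hk
    exact hi ▸ Nat.le_succ _
  · exact (hj k hk).ge

/-- The row among the first three in which a box is added to reach a partition whose first three
parts have the same parity is determined by the starting partition. -/
theorem row_unique_of_parity {p q q' : ℕ → ℕ} {a b : Fin 3}
    (hq : q = p + Pi.single (a : ℕ) 1) (hq' : q' = p + Pi.single (b : ℕ) 1)
    (h01 : q 0 % 2 = q 1 % 2) (h12 : q 1 % 2 = q 2 % 2)
    (h01' : q' 0 % 2 = q' 1 % 2) (h12' : q' 1 % 2 = q' 2 % 2) : a = b := by
  subst hq hq'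
  fin_cases a <;> fin_cases b <;> simp at * <;> omega

/-- In a chain of box additions ending in at most three nonzero parts, every member has at most
three nonzero parts. -/
theorem chain_eq_zero_of_last {d : ℕ} {c : Fin d → ℕ → ℕ}
    (hstep : ∀ (j : ℕ) (hj : j + 1 < d),
      AddBox (c ⟨j, Nat.lt_of_succ_lt hj⟩) (c ⟨j + 1, hj⟩))
    (hd : d - 1 < d) (hlast : ∀ i, 3 ≤ i → c ⟨d - 1, hd⟩ i = 0)
    (j : ℕ) (hj : j < d) (i : ℕ) (hi : 3 ≤ i) : c ⟨j, hj⟩ i = 0 := by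
  have hmono : Monotone c := by
    obtain ⟨n, rfl⟩ : ∃ n, d = n + 1 := ⟨d - 1, by omega⟩
    exact Fin.monotone_iff_le_succ.2 fun k => (hstep k (by omega)).le
  have hle : (⟨j, hj⟩ : Fin d) ≤ ⟨d - 1, hd⟩ := Fin.mk_le_mk.2 (by omega)
  exact Nat.le_zero.1 ((hmono hle i).trans_eq (hlast i hi))

/-- Let `d ≥ 3` and let `λ` be any partition. The set of chains
`λ = λ⁽⁰⁾ ⊂ λ⁽¹⁾ ⊂ ⋯ ⊂ λ⁽ᵈ⁻¹⁾` of partitions, each obtained from the previous one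
by adding one box, whose final partition `μ = λ⁽ᵈ⁻¹⁾ = (μ₁, μ₂, μ₃)` has at most
`3` non-zero parts with `μ₁ ≡ μ₂ ≡ μ₃ (mod 2)`, is finite of cardinality at most
`3^(d-2)`. -/
theorem stmt15 (d : ℕ) (hd : 3 ≤ d) (lam : ℕ → ℕ) (hlam : IsPartitionFun lam) :
    ({c : Fin d → ℕ → ℕ |
        c ⟨0, by omega⟩ = lam ∧
        (∀ j : Fin d, IsPartitionFun (c j)) ∧
        (∀ (j : ℕ) (hj : j + 1 < d),
          AddBox (c ⟨j, Nat.lt_of_succ_lt hj⟩) (c ⟨j + 1, hj⟩)) ∧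
        (∀ i : ℕ, 3 ≤ i → c ⟨d - 1, by omega⟩ i = 0) ∧
        c ⟨d - 1, by omega⟩ 0 % 2 = c ⟨d - 1, by omega⟩ 1 % 2 ∧
        c ⟨d - 1, by omega⟩ 1 % 2 = c ⟨d - 1, by omega⟩ 2 % 2} : Set (Fin d → ℕ → ℕ)).Finite ∧
    ({c : Fin d → ℕ → ℕ |
        c ⟨0, by omega⟩ = lam ∧
        (∀ j : Fin d, IsPartitionFun (c j)) ∧
        (∀ (j : ℕ) (hj : j + 1 < d),
          AddBox (c ⟨j, Nat.lt_of_succ_lt hj⟩) (c ⟨j + 1, hj⟩)) ∧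
        (∀ i : ℕ, 3 ≤ i → c ⟨d - 1, by omega⟩ i = 0) ∧
        c ⟨d - 1, by omega⟩ 0 % 2 = c ⟨d - 1, by omega⟩ 1 % 2 ∧
        c ⟨d - 1, by omega⟩ 1 % 2 = c ⟨d - 1, by omega⟩ 2 % 2} : Set (Fin d → ℕ → ℕ)).ncard
      ≤ 3 ^ (d - 2) := by
  set S := {c : Fin d → ℕ → ℕ |
        c ⟨0, by omega⟩ = lam ∧
        (∀ j : Fin d, IsPartitionFun (c j)) ∧
        (∀ (j : ℕ) (hj : j + 1 < d),
          AddBox (c ⟨j, Nat.lt_of_succ_lt hj⟩) (c ⟨j + 1, hj⟩)) ∧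
        (∀ i : ℕ, 3 ≤ i → c ⟨d - 1, by omega⟩ i = 0) ∧
        c ⟨d - 1, by omega⟩ 0 % 2 = c ⟨d - 1, by omega⟩ 1 % 2 ∧
        c ⟨d - 1, by omega⟩ 1 % 2 = c ⟨d - 1, by omega⟩ 2 % 2}
  have hrow : ∀ c ∈ S, ∀ (j : ℕ) (hj : j + 1 < d), ∃ a : Fin 3,
      c ⟨j + 1, hj⟩ = c ⟨j, Nat.lt_of_succ_lt hj⟩ + Pi.single (a : ℕ) 1 := by
    rintro c ⟨-, -, hstep, hlast, -⟩ j hj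
    exact (hstep j hj).exists_fin_three (chain_eq_zero_of_last hstep _ hlast _ _)
  have hword : ∀ c ∈ S, ∃ w : Fin (d - 2) → Fin 3, ∀ (j : ℕ) (hj : j < d - 2),
      c ⟨j + 1, by omega⟩ = c ⟨j, by omega⟩ + Pi.single (w ⟨j, hj⟩ : ℕ) 1 := by
    intro c hc
    choose w hw using fun j : Fin (d - 2) => hrow c hc j (by omega)
    exact ⟨w, fun j hj => hw ⟨j, hj⟩⟩
  choose! w hw using hword
  have hinj : Set.InjOn w S := by
    intro c hc c' hc' hww
    have hinit : ∀ (j : ℕ) (hj : j < d - 1), c ⟨j, by omega⟩ = c' ⟨j, by omega⟩ := by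
      intro j
      induction j with
      | zero => exact fun _ => hc.1.trans hc'.1.symm
      | succ j ih =>
        intro hj
        rw [hw c hc j (by omega), hw c' hc' j (by omega), hww, ih (by omega)]
    have hlast : c ⟨d - 1, by omega⟩ = c' ⟨d - 1, by omega⟩ := by
      have hidx : (⟨d - 2 + 1, by omega⟩ : Fin d) = ⟨d - 1, by omega⟩ := Fin.ext (by simp; omega)
      obtain ⟨a, ha⟩ := hrow c hc (d - 2) (by omega)
      obtain ⟨b, hb⟩ := hrow c' hc' (d - 2) (by omega)
      rw [hidx] at ha hb
      rw [← hinit (d - 2) (by omega)] at hb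
      obtain ⟨-, -, -, -, h01, h12⟩ := hc
      obtain ⟨-, -, -, -, h01', h12'⟩ := hc'
      rw [ha, hb, row_unique_of_parity ha hb h01 h12 h01' h12']
    funext ⟨j, hj⟩
    rcases Nat.lt_or_ge j (d - 1) with hlt | hge
    · exact hinit j hlt
    · obtain rfl : j = d - 1 := by omega
      exact hlast
  refine ⟨Set.Finite.of_injOn (Set.mapsTo_univ w S) hinj Set.finite_univ, ?_⟩
  calc S.ncard ≤ (Set.univ : Set (Fin (d - 2) → Fin 3)).ncard :=
        Set.ncard_le_ncard_of_injOn w (fun _ _ => Set.mem_univ _) hinj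
    _ = 3 ^ (d - 2) := by simp [Set.ncard_univ]
end

section
/- Let d ≥ 2. The (d−1)×(d−1) complex matrix Z whose entry in row i and column k+1 (for 1 ≤ i ≤ d−1, 0 ≤ k ≤ d−2) is Z_{i,k+1} = i·(d+1−2i)^k·(d−1−2i)^{d−2−k} has nonzero determinant. -/
/-- For `d ≥ 2`, the `(d-1)×(d-1)` matrix `Z` with entries
`Z_{i,k+1} = i·(d+1-2i)ᵏ·(d-1-2i)^{d-2-k}` (for `1 ≤ i ≤ d-1`, `0 ≤ k ≤ d-2`,
written with 0-based row index `a = i-1` and column index `k`; convention `0⁰ = 1`)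
has nonzero determinant. -/
theorem stmt17 (d : ℕ) (hd : 2 ≤ d) :
    (Matrix.of (fun a k : Fin (d - 1) =>
        (((a : ℕ) + 1 : ℕ) : ℂ) * ((d : ℂ) + 1 - 2 * (((a : ℕ) + 1 : ℕ) : ℂ)) ^ (k : ℕ) *
          ((d : ℂ) - 1 - 2 * (((a : ℕ) + 1 : ℕ) : ℂ)) ^ (d - 2 - (k : ℕ)))).det ≠ 0 := by
  have hZ : (Matrix.of (fun a k : Fin (d - 1) =>
        (((a : ℕ) + 1 : ℕ) : ℂ) * ((d : ℂ) + 1 - 2 * (((a : ℕ) + 1 : ℕ) : ℂ)) ^ (k : ℕ) *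
          ((d : ℂ) - 1 - 2 * (((a : ℕ) + 1 : ℕ) : ℂ)) ^ (d - 2 - (k : ℕ)))) =
      Matrix.of (fun a k : Fin (d - 1) => (((a : ℕ) + 1 : ℕ) : ℂ) *
        Matrix.projVandermonde
          (fun a : Fin (d - 1) => (d : ℂ) + 1 - 2 * (((a : ℕ) + 1 : ℕ) : ℂ))
          (fun a : Fin (d - 1) => (d : ℂ) - 1 - 2 * (((a : ℕ) + 1 : ℕ) : ℂ)) a k) := by
    ext a k
    have hk : d - 2 - (k : ℕ) = (k.rev : ℕ) := by
      rw [Fin.val_rev]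
      omega
    simp only [Matrix.of_apply, Matrix.projVandermonde_apply, hk, mul_assoc]
  rw [hZ, Matrix.det_mul_column, Matrix.det_projVandermonde]
  refine mul_ne_zero (Finset.prod_ne_zero_iff.2 fun a _ => Nat.cast_ne_zero.2 a.val.succ_ne_zero)
    (Finset.prod_ne_zero_iff.2 fun i _ => Finset.prod_ne_zero_iff.2 fun j hj => ?_)
  have hij : (4 : ℂ) * (((j : ℕ) : ℂ) - ((i : ℕ) : ℂ)) ≠ 0 :=
    mul_ne_zero (by norm_num)
      (sub_ne_zero.2 (Nat.cast_injective.ne (Fin.val_injective.ne (Finset.mem_Ioi.1 hj).ne')))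
  convert hij using 1
  push_cast
  ring
end
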